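/- arXiv:1405.4980 — 2 statements merged into one kernel-verified Lean document; each statement's English description precedes it below -/
import Mathlib

section
/- Let ‖·‖ be an arbitrary norm on ℝⁿ, let X ⊆ ℝⁿ be a compact convex set with R = sup_{x,y ∈ X} ‖x - y‖, and let f : ℝⁿ → ℝ be convex and differentiable with ‖∇f(x) - ∇f(y)‖_* ≤ β‖x - y‖ for all x, y ∈ X (β > 0). Let x* minimize f over X. Starting from any x₁ ∈ X, define for s ≥ 1: y_s ∈ X with ⟪∇f(x_s), y_s⟫ ≤ ⟪∇f(x_s), y⟫ for all y ∈ X, and x_{s+1} = (1 - γ_s) x_s + γ_s y_s with γ_s = 2/(s+1). Then for every t ≥ 2, f(x_t) - f(x*) ≤ 2βR²/(t+1). -/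
open scoped RealInnerProductSpace

section FrankWolfe

variable {E : Type*} [NormedAddCommGroup E] [InnerProductSpace ℝ E] [FiniteDimensional ℝ E]

/-- A seminorm on a finite-dimensional real space is continuous. -/
theorem Seminorm.continuous_of_finiteDimensional_real (N : Seminorm ℝ E) : Continuous N :=
  N.convexOn.locallyLipschitz.continuous

/-- A definite seminorm on a finite-dimensional real space dominates a multiple of the norm. -/
theorem Seminorm.exists_pos_mul_norm_le (N : Seminorm ℝ E) (hN : ∀ x, N x = 0 → x = 0) :
    ∃ c > 0, ∀ z, c * ‖z‖ ≤ N z := by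
  obtain ⟨c, hc, h⟩ := (isCompact_sphere (0 : E) 1).exists_forall_le' (a := 0)
    N.continuous_of_finiteDimensional_real.continuousOn (fun b hb => by
      refine lt_of_le_of_ne (apply_nonneg N b) fun h0 => ?_
      simp [hN b h0.symm] at hb)
  refine ⟨c, hc, fun z => ?_⟩
  rcases eq_or_ne z 0 with rfl | hz
  · simp
  have hz' : 0 < ‖z‖ := norm_pos_iff.mpr hz
  have := h (‖z‖⁻¹ • z) (by simp [norm_smul, hz'.ne'])
  rw [map_smul_eq_mul, norm_inv, norm_norm, inv_mul_eq_div, le_div_iff₀ hz'] at this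
  exact this

/-- The dual-norm inequality `⟪g, v⟫ ≤ ‖g‖_* N v` for a definite seminorm. -/
theorem Seminorm.inner_le_sSup_mul (N : Seminorm ℝ E) (hN : ∀ x, N x = 0 → x = 0) (g v : E) :
    ⟪g, v⟫ ≤ sSup {d : ℝ | ∃ z : E, N z ≤ 1 ∧ d = ⟪g, z⟫} * N v := by
  obtain ⟨c, hc, h⟩ := N.exists_pos_mul_norm_le hN
  have hbdd : BddAbove {d : ℝ | ∃ z : E, N z ≤ 1 ∧ d = ⟪g, z⟫} := by
    refine ⟨‖g‖ * (1 / c), ?_⟩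
    rintro _ ⟨z, hz, rfl⟩
    refine (real_inner_le_norm g z).trans (mul_le_mul_of_nonneg_left ?_ (norm_nonneg g))
    rw [le_div_iff₀ hc, mul_comm]
    exact (h z).trans hz
  rcases eq_or_ne v 0 with rfl | hv
  · simp
  have hv' : 0 < N v := lt_of_le_of_ne (apply_nonneg N v) fun h0 => hv (hN v h0.symm)
  have := le_csSup hbdd ⟨(N v)⁻¹ • v, by
    rw [map_smul_eq_mul, norm_inv, Real.norm_of_nonneg hv'.le, inv_mul_cancel₀ hv'.ne'], rfl⟩
  rwa [real_inner_smul_right, inv_mul_eq_div, div_le_iff₀ hv'] at this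

/-- The derivative of a differentiable function along a line, in terms of its gradient. -/
theorem Differentiable.hasDerivAt_comp_add_smul {f : E → ℝ} (hf : Differentiable ℝ f)
    (a v : E) (t : ℝ) :
    HasDerivAt (fun t : ℝ => f (a + t • v)) ⟪gradient f (a + t • v), v⟫ t := by
  have hline : HasDerivAt (fun t : ℝ => a + t • v) v t := by
    simpa using ((hasDerivAt_id t).smul_const v).const_add a
  rw [inner_gradient_left]
  exact (hf (a + t • v)).hasFDerivAt.comp_hasDerivAt t hline

/-- The first-order lower bound for a differentiable convex function. -/
theorem ConvexOn.inner_gradient_le_sub {f : E → ℝ} (hconv : ConvexOn ℝ Set.univ f)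
    (hf : Differentiable ℝ f) (a b : E) : ⟪gradient f a, b - a⟫ ≤ f b - f a := by
  have hc : ConvexOn ℝ Set.univ (fun t : ℝ => f (a + t • (b - a))) := by
    have := hconv.comp_affineMap (AffineMap.lineMap (k := ℝ) a b)
    convert! this using 2 with t
    simp [AffineMap.lineMap_apply, add_comm]
  have := hc.le_slope_of_hasDerivAt (Set.mem_univ 0) (Set.mem_univ 1) one_pos
    (hf.hasDerivAt_comp_add_smul a (b - a) 0)
  simpa [slope_def_field] using this

/-- The quadratic upper bound for a function that is smooth with respect to a norm `N`. -/
theorem sub_le_inner_gradient_add_of_smooth (N : Seminorm ℝ E) (hN : ∀ x, N x = 0 → x = 0)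
    {X : Set E} (hX : Convex ℝ X) {f : E → ℝ} (hf : Differentiable ℝ f) {β : ℝ}
    (hsmooth : ∀ x ∈ X, ∀ y ∈ X,
      sSup {d : ℝ | ∃ z : E, N z ≤ 1 ∧ d = ⟪gradient f x - gradient f y, z⟫} ≤ β * N (x - y))
    {a b : E} (ha : a ∈ X) (hb : b ∈ X) :
    f b - f a ≤ ⟪gradient f a, b - a⟫ + β / 2 * N (b - a) ^ 2 := by
  set v := b - a with hv
  have hder (t : ℝ) : HasDerivAt
      (fun t : ℝ => f (a + t • v) - t * ⟪gradient f a, v⟫ - β / 2 * N v ^ 2 * t ^ 2)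
      (⟪gradient f (a + t • v), v⟫ - ⟪gradient f a, v⟫ - β * N v ^ 2 * t) t := by
    have h1 := (hasDerivAt_id t).mul_const ⟪gradient f a, v⟫
    have h2 := (hasDerivAt_pow 2 t).const_mul (β / 2 * N v ^ 2)
    convert! ((hf.hasDerivAt_comp_add_smul a v t).sub h1).sub h2 using 1
    norm_num
    ring
  have hanti := antitoneOn_of_hasDerivWithinAt_nonpos (convex_Icc (0 : ℝ) 1)
    (fun t _ => (hder t).continuousAt.continuousWithinAt)
    (fun t _ => (hder t).hasDerivWithinAt) (fun t ht => by
      rw [interior_Icc] at ht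
      have hmem : a + t • v ∈ X := hX.add_smul_sub_mem ha hb ⟨ht.1.le, ht.2.le⟩
      have h1 := N.inner_le_sSup_mul hN (gradient f (a + t • v) - gradient f a) v
      have h2 := mul_le_mul_of_nonneg_right (hsmooth _ hmem a ha) (apply_nonneg N v)
      rw [add_sub_cancel_left, map_smul_eq_mul, Real.norm_of_nonneg ht.1.le] at h2
      rw [inner_sub_left] at h1
      linarith)
  have := hanti (Set.left_mem_Icc.mpr zero_le_one) (Set.right_mem_Icc.mpr zero_le_one) zero_le_one
  simp [hv] at this ⊢
  linarith

end FrankWolfe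

/-- Convergence rate of conditional gradient descent (Frank-Wolfe) for functions
that are smooth with respect to an arbitrary norm `N` on ℝⁿ. -/
theorem stmt_7 (n : ℕ) (N : Seminorm ℝ (EuclideanSpace ℝ (Fin n)))
    (hN : ∀ x, N x = 0 → x = 0)
    (X : Set (EuclideanSpace ℝ (Fin n)))
    (hXcomp : IsCompact X) (hXconv : Convex ℝ X)
    (R : ℝ) (hR : R = sSup {d : ℝ | ∃ x ∈ X, ∃ y ∈ X, d = N (x - y)})
    (f : EuclideanSpace ℝ (Fin n) → ℝ)
    (hconv : ConvexOn ℝ Set.univ f) (hdiff : Differentiable ℝ f)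
    (β : ℝ) (hβ : 0 < β)
    (hsmooth : ∀ x ∈ X, ∀ y ∈ X,
      sSup {d : ℝ | ∃ z : EuclideanSpace ℝ (Fin n), N z ≤ 1 ∧
          d = ⟪gradient f x - gradient f y, z⟫} ≤ β * N (x - y))
    (xstar : EuclideanSpace ℝ (Fin n)) (hxstar : xstar ∈ X)
    (hmin : ∀ z ∈ X, f xstar ≤ f z)
    (γ : ℕ → ℝ) (hγ : ∀ s : ℕ, γ s = 2 / ((s : ℝ) + 1))
    (x y : ℕ → EuclideanSpace ℝ (Fin n))
    (hx1 : x 1 ∈ X)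
    (hy : ∀ s ≥ 1, y s ∈ X ∧ ∀ z ∈ X, ⟪gradient f (x s), y s⟫ ≤ ⟪gradient f (x s), z⟫)
    (hx : ∀ s ≥ 1, x (s + 1) = (1 - γ s) • x s + γ s • y s)
    (t : ℕ) (ht : 2 ≤ t) :
    f (x t) - f xstar ≤ 2 * β * R ^ 2 / ((t : ℝ) + 1) := by
  have hdist : ∀ a ∈ X, ∀ b ∈ X, N (a - b) ≤ R := by
    intro a ha b hb
    have hbdd : BddAbove {d : ℝ | ∃ x ∈ X, ∃ y ∈ X, d = N (x - y)} := by
      refine ((hXcomp.prod hXcomp).image (N.continuous_of_finiteDimensional_real.comp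
        (continuous_fst.sub continuous_snd))).bddAbove.mono ?_
      rintro _ ⟨u, hu, w, hw, rfl⟩
      exact ⟨(u, w), ⟨hu, hw⟩, rfl⟩
    rw [hR]
    exact le_csSup hbdd ⟨a, ha, b, hb, rfl⟩
  have hγ_mem : ∀ s ≥ 1, 0 ≤ γ s ∧ γ s ≤ 1 := by
    intro s hs
    have hs' : (1 : ℝ) ≤ s := by exact_mod_cast hs
    rw [hγ]
    exact ⟨by positivity, by rw [div_le_one (by positivity)]; linarith⟩
  have hxX : ∀ s ≥ 1, x s ∈ X := by
    intro s hs
    induction s, hs using Nat.le_induction with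
    | base => exact hx1
    | succ s hs ih =>
      rw [hx s hs]
      obtain ⟨h0, h1⟩ := hγ_mem s hs
      exact hXconv ih (hy s hs).1 (by linarith) h0 (by ring)
  have hstep : ∀ s ≥ 1, f (x (s + 1)) - f xstar ≤
      (1 - γ s) * (f (x s) - f xstar) + β / 2 * γ s ^ 2 * R ^ 2 := by
    intro s hs
    obtain ⟨h0, -⟩ := hγ_mem s hs
    have hdesc := sub_le_inner_gradient_add_of_smooth N hN hXconv hdiff hsmooth
      (hxX s hs) (hxX (s + 1) (by omega))
    have hdir : x (s + 1) - x s = γ s • (y s - x s) := by rw [hx s hs]; module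
    rw [hdir, real_inner_smul_right, map_smul_eq_mul, Real.norm_of_nonneg h0] at hdesc
    have hopt := (hy s hs).2 xstar hxstar
    have hgrad := hconv.inner_gradient_le_sub hdiff (x s) xstar
    rw [inner_sub_right] at hgrad hdesc
    have hlin := mul_le_mul_of_nonneg_left
      (show ⟪gradient f (x s), y s⟫ - ⟪gradient f (x s), x s⟫ ≤ f xstar - f (x s) by linarith) h0
    have hsq : N (y s - x s) ^ 2 ≤ R ^ 2 :=
      pow_le_pow_left₀ (apply_nonneg N _) (hdist _ (hy s hs).1 _ (hxX s hs)) 2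
    have hquad := mul_le_mul_of_nonneg_left hsq (show 0 ≤ β / 2 * γ s ^ 2 by positivity)
    linarith
  induction t, ht using Nat.le_induction with
  | base =>
    have h := hstep 1 le_rfl
    have hγ1 : γ 1 = 1 := by rw [hγ]; norm_num
    rw [hγ1] at h
    norm_num at h ⊢
    have : 0 ≤ β * R ^ 2 := by positivity
    linarith
  | succ s hs ih =>
    have hs' : (2 : ℝ) ≤ s := by exact_mod_cast hs
    have h := hstep s (by omega)
    obtain ⟨-, h1⟩ := hγ_mem s (by omega)
    refine h.trans <| (add_le_add_left (mul_le_mul_of_nonneg_left ih (sub_nonneg.mpr h1)) _).trans ?_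
    rw [hγ]
    push_cast
    have hK : 0 ≤ β * R ^ 2 := by positivity
    have heq : (1 - 2 / ((s : ℝ) + 1)) * (2 * β * R ^ 2 / (s + 1)) +
        β / 2 * (2 / ((s : ℝ) + 1)) ^ 2 * R ^ 2 = 2 * β * R ^ 2 * s / (s + 1) ^ 2 := by
      field_simp
      ring
    rw [heq, div_le_div_iff₀ (by positivity) (by positivity)]
    nlinarith
end

section
/- Let ℓ² be the Hilbert space of square-summable real sequences, let α > 0 and κ > 1, and set β = κα. There exists a differentiable function f : ℓ² → ℝ that is β-smooth and α-strongly convex and admits a minimizer x*, such that every sequence (x_s)_{s≥1} in ℓ² with x₁ = 0 and x_{s+1} ∈ span{∇f(x₁), …, ∇f(x_s)} for all s ≥ 1 satisfies, for every t ≥ 1, f(x_t) - f(x*) ≥ (α/2) · ((√κ - 1)/(√κ + 1))^{2(t-1)} · ‖x₁ - x*‖². -/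
open scoped RealInnerProductSpace ENNReal

section Quadratic

variable {E : Type*} [NormedAddCommGroup E] [InnerProductSpace ℝ E]

theorem quadratic_sub_quadratic {T : E →L[ℝ] E} (hT : ∀ x y, ⟪T x, y⟫ = ⟪x, T y⟫) (b x y : E) :
    (1 / 2 * ⟪T x, x⟫ - ⟪b, x⟫) - (1 / 2 * ⟪T y, y⟫ - ⟪b, y⟫) =
      ⟪T x - b, x - y⟫ - 1 / 2 * ⟪T (x - y), x - y⟫ := by
  have h : ⟪T y, x⟫ = ⟪T x, y⟫ := by rw [hT, real_inner_comm]
  simp only [map_sub, inner_sub_left, inner_sub_right]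
  linarith

theorem hasGradientAt_quadratic [CompleteSpace E] {T : E →L[ℝ] E}
    (hT : ∀ x y, ⟪T x, y⟫ = ⟪x, T y⟫) (b x : E) :
    HasGradientAt (fun x => 1 / 2 * ⟪T x, x⟫ - ⟪b, x⟫) (T x - b) x := by
  rw [hasGradientAt_iff_hasFDerivAt]
  have h₁ := ((T.hasFDerivAt (x := x)).inner ℝ (hasFDerivAt_id x)).const_mul (1 / 2 : ℝ)
  have h₂ := (innerSL ℝ b).hasFDerivAt (x := x)
  refine (h₁.sub h₂).congr_fderiv ?_
  ext y
  simp [fderivInnerCLM_apply]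
  rw [hT y x, real_inner_comm]
  ring

end Quadratic

section Shift

/-- The left shift on `ℓ²(ℕ)`, of norm at most one. -/
noncomputable def leftShift : lp (fun _ : ℕ => ℝ) 2 →L[ℝ] lp (fun _ : ℕ => ℝ) 2 :=
  LinearMap.mkContinuous
    { toFun := fun x => ⟨fun i => x (i + 1), by
        have h := (lp.memℓp x).summable (by norm_num)
        exact memℓp_gen (h.comp_injective (add_left_injective 1))⟩
      map_add' := fun x y => by ext i; rfl
      map_smul' := fun c x => by ext i; rfl } 1 (by
    intro x
    rw [one_mul]
    refine lp.norm_le_of_forall_sum_le (by norm_num) (norm_nonneg x) fun s => ?_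
    refine le_trans (le_of_eq ?_)
      (lp.sum_rpow_le_norm_rpow (by norm_num) x (s.map (addRightEmbedding 1)))
    simp)

@[simp]
theorem leftShift_apply (x : lp (fun _ : ℕ => ℝ) 2) (i : ℕ) : leftShift x i = x (i + 1) := rfl

theorem norm_leftShift_le : ‖leftShift‖ ≤ 1 :=
  LinearMap.mkContinuous_norm_le _ zero_le_one _

theorem norm_leftShift_apply_le (x : lp (fun _ : ℕ => ℝ) 2) : ‖leftShift x‖ ≤ ‖x‖ := by
  simpa using leftShift.le_of_opNorm_le norm_leftShift_le x

theorem leftShift_pow_apply (k : ℕ) (x : lp (fun _ : ℕ => ℝ) 2) (i : ℕ) :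
    (leftShift ^ k) x i = x (i + k) := by
  induction k generalizing i with
  | zero => simp
  | succ k ih =>
    rw [pow_succ', mul_apply_eq_comp, leftShift_apply, ih, Nat.add_right_comm, Nat.add_assoc]

theorem norm_leftShift_pow_apply_le (k : ℕ) (x : lp (fun _ : ℕ => ℝ) 2) :
    ‖(leftShift ^ k) x‖ ≤ ‖x‖ := by
  induction k with
  | zero => simp
  | succ k ih =>
    rw [pow_succ', mul_apply_eq_comp]
    exact (norm_leftShift_apply_le _).trans ih

theorem adjoint_leftShift_apply (x : lp (fun _ : ℕ => ℝ) 2) (i : ℕ) :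
    leftShift.adjoint x i = ⟪leftShift (lp.single 2 i (1 : ℝ)), x⟫ := by
  rw [← ContinuousLinearMap.adjoint_inner_right, lp.inner_single_left]
  simp

theorem adjoint_leftShift_apply_zero (x : lp (fun _ : ℕ => ℝ) 2) :
    leftShift.adjoint x 0 = 0 := by
  have h : leftShift (lp.single 2 0 (1 : ℝ)) = 0 := by
    ext i
    simp [lp.single_apply]
  rw [adjoint_leftShift_apply, h, inner_zero_left]

theorem adjoint_leftShift_apply_succ (x : lp (fun _ : ℕ => ℝ) 2) (i : ℕ) :
    leftShift.adjoint x (i + 1) = x i := by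
  have h : leftShift (lp.single 2 (i + 1) (1 : ℝ)) = lp.single 2 i (1 : ℝ) := by
    ext j
    simp [lp.single_apply, Pi.single_apply]
  rw [adjoint_leftShift_apply, h, lp.inner_single_left]
  simp

/-- The operator `c • (2 - L - L†) + α`, with `L` the left shift. -/
noncomputable def shiftedLaplacian (c α : ℝ) :
    lp (fun _ : ℕ => ℝ) 2 →L[ℝ] lp (fun _ : ℕ => ℝ) 2 :=
  (2 * c + α) • ContinuousLinearMap.id ℝ _ - c • (leftShift + leftShift.adjoint)

theorem shiftedLaplacian_apply (c α : ℝ) (x : lp (fun _ : ℕ => ℝ) 2) :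
    shiftedLaplacian c α x =
      (2 * c + α) • x - c • (leftShift x + leftShift.adjoint x) := rfl

theorem shiftedLaplacian_apply_apply (c α : ℝ) (x : lp (fun _ : ℕ => ℝ) 2) (i : ℕ) :
    shiftedLaplacian c α x i =
      (2 * c + α) * x i - c * (x (i + 1) + leftShift.adjoint x i) := rfl

theorem inner_shiftedLaplacian_left (c α : ℝ) (x y : lp (fun _ : ℕ => ℝ) 2) :
    ⟪shiftedLaplacian c α x, y⟫ = ⟪x, shiftedLaplacian c α y⟫ := by
  simp only [shiftedLaplacian_apply, inner_sub_left, inner_sub_right, inner_add_left,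
    inner_add_right, real_inner_smul_left, real_inner_smul_right,
    ContinuousLinearMap.adjoint_inner_left, ContinuousLinearMap.adjoint_inner_right]
  ring

theorem norm_shiftedLaplacian_apply_le {c α : ℝ} (hc : 0 ≤ c) (hα : 0 ≤ α)
    (x : lp (fun _ : ℕ => ℝ) 2) : ‖shiftedLaplacian c α x‖ ≤ (4 * c + α) * ‖x‖ := by
  have hL := norm_leftShift_apply_le x
  have hR : ‖leftShift.adjoint x‖ ≤ ‖x‖ := by
    simpa using leftShift.adjoint.le_of_opNorm_le
      ((LinearIsometryEquiv.norm_map ContinuousLinearMap.adjoint _).trans_le norm_leftShift_le) x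
  rw [shiftedLaplacian_apply]
  calc _ ≤ ‖(2 * c + α) • x‖ + ‖c • (leftShift x + leftShift.adjoint x)‖ := norm_sub_le _ _
    _ ≤ (2 * c + α) * ‖x‖ + c * (‖x‖ + ‖x‖) := by
      rw [norm_smul, norm_smul, Real.norm_of_nonneg hc, Real.norm_of_nonneg (by positivity)]
      gcongr
      exact (norm_add_le _ _).trans (add_le_add hL hR)
    _ = _ := by ring

theorem mul_norm_sq_le_inner_shiftedLaplacian {c : ℝ} (hc : 0 ≤ c) (α : ℝ)
    (x : lp (fun _ : ℕ => ℝ) 2) : α * ‖x‖ ^ 2 ≤ ⟪shiftedLaplacian c α x, x⟫ := by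
  have h : ⟪leftShift x, x⟫ ≤ ‖x‖ ^ 2 := by
    refine (real_inner_le_norm _ _).trans ?_
    rw [sq]
    gcongr
    exact norm_leftShift_apply_le x
  rw [shiftedLaplacian_apply, inner_sub_left, real_inner_smul_left, real_inner_smul_left,
    inner_add_left, ContinuousLinearMap.adjoint_inner_left, real_inner_self_eq_norm_sq,
    real_inner_comm (leftShift x) x]
  nlinarith [mul_le_mul_of_nonneg_left h hc]

/-- The sequences in `ℓ²` supported on the first `k` coordinates. -/
def supportedBelow (k : ℕ) : Submodule ℝ (lp (fun _ : ℕ => ℝ) 2) where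
  carrier := {x | ∀ i, k ≤ i → x i = 0}
  zero_mem' := fun i _ => rfl
  add_mem' := fun {x y} hx hy i hi => by simp [hx i hi, hy i hi]
  smul_mem' := fun c x hx i hi => by simp [hx i hi]

theorem supportedBelow_mono {k l : ℕ} (h : k ≤ l) : supportedBelow k ≤ supportedBelow l :=
  fun _ hx i hi => hx i (h.trans hi)

theorem single_zero_mem_supportedBelow_succ (k : ℕ) (a : ℝ) :
    (lp.single 2 0 a : lp (fun _ : ℕ => ℝ) 2) ∈ supportedBelow (k + 1) := fun i hi => by
  have : i ≠ 0 := by omega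
  simp [lp.single_apply, this]

theorem shiftedLaplacian_mem_supportedBelow_succ (c α : ℝ) {k : ℕ}
    {x : lp (fun _ : ℕ => ℝ) 2} (hx : x ∈ supportedBelow k) :
    shiftedLaplacian c α x ∈ supportedBelow (k + 1) := by
  rintro (_ | i) hi
  · omega
  · simp [shiftedLaplacian_apply_apply, adjoint_leftShift_apply_succ, hx i (by omega),
      hx (i + 1) (by omega), hx (i + 1 + 1) (by omega)]

theorem leftShift_pow_eq_zero {k : ℕ} {x : lp (fun _ : ℕ => ℝ) 2} (hx : x ∈ supportedBelow k) :
    (leftShift ^ k) x = 0 := by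
  ext i
  rw [leftShift_pow_apply, hx _ (by omega)]
  rfl

/-- The geometric sequence `q, q², q³, …` as an element of `ℓ²`. -/
noncomputable def geometricSeq (q : ℝ) (h₀ : 0 ≤ q) (h₁ : q < 1) : lp (fun _ : ℕ => ℝ) 2 :=
  ⟨fun i => q ^ (i + 1), by
    refine memℓp_gen ?_
    have h : Summable fun i : ℕ => q ^ 2 * (q ^ 2) ^ i :=
      (summable_geometric_of_lt_one (sq_nonneg q) (by nlinarith)).mul_left _
    refine h.congr fun i => ?_
    rw [Real.norm_of_nonneg (by positivity)]
    simp
    ring⟩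

@[simp]
theorem geometricSeq_apply (q : ℝ) (h₀ : 0 ≤ q) (h₁ : q < 1) (i : ℕ) :
    geometricSeq q h₀ h₁ i = q ^ (i + 1) := rfl

theorem leftShift_pow_geometricSeq (q : ℝ) (h₀ : 0 ≤ q) (h₁ : q < 1) (k : ℕ) :
    (leftShift ^ k) (geometricSeq q h₀ h₁) = q ^ k • geometricSeq q h₀ h₁ := by
  ext i
  rw [leftShift_pow_apply]
  simp
  ring

theorem shiftedLaplacian_geometricSeq {c α q : ℝ} (h₀ : 0 ≤ q) (h₁ : q < 1)
    (h : (2 * c + α) * q = c * (q ^ 2 + 1)) :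
    shiftedLaplacian c α (geometricSeq q h₀ h₁) = lp.single 2 0 c := by
  ext (_ | i)
  · simp [shiftedLaplacian_apply_apply, adjoint_leftShift_apply_zero]
    linear_combination h
  · simp [shiftedLaplacian_apply_apply, adjoint_leftShift_apply_succ]
    linear_combination q ^ (i + 1) * h

theorem pow_mul_norm_geometricSeq_le {q : ℝ} (h₀ : 0 ≤ q) (h₁ : q < 1) {k : ℕ}
    {x : lp (fun _ : ℕ => ℝ) 2} (hx : x ∈ supportedBelow k) :
    q ^ k * ‖geometricSeq q h₀ h₁‖ ≤ ‖geometricSeq q h₀ h₁ - x‖ := by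
  have h := norm_leftShift_pow_apply_le k (geometricSeq q h₀ h₁ - x)
  rwa [map_sub, leftShift_pow_eq_zero hx, sub_zero, leftShift_pow_geometricSeq, norm_smul,
    Real.norm_of_nonneg (by positivity)] at h

/-- If `g` enlarges supports by at most one coordinate, then so does every step of a sequence
that starts at `0` and stays in the span of the previous values of `g`. -/
theorem mem_supportedBelow_of_mem_span {g : lp (fun _ : ℕ => ℝ) 2 → lp (fun _ : ℕ => ℝ) 2}
    (hg : ∀ k, ∀ x ∈ supportedBelow k, g x ∈ supportedBelow (k + 1))
    {x : ℕ → lp (fun _ : ℕ => ℝ) 2} (hx₁ : x 1 = 0)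
    (hx : ∀ s, 1 ≤ s → x (s + 1) ∈ Submodule.span ℝ ((fun r => g (x r)) '' Set.Icc 1 s))
    (k : ℕ) : x (k + 1) ∈ supportedBelow k := by
  induction k using Nat.strong_induction_on with
  | _ k ih =>
    rcases k with _ | k
    · simp [hx₁]
    · refine Submodule.span_le.2 ?_ (hx (k + 1) (by omega))
      rintro _ ⟨r, ⟨hr₁, hr₂⟩, rfl⟩
      obtain ⟨j, rfl⟩ := Nat.exists_eq_add_of_le' hr₁
      exact supportedBelow_mono hr₂ (hg j _ (ih j (by omega)))

end Shift

/-- Oracle complexity lower bound for smooth strongly convex optimization in `ℓ²`. -/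
theorem stmt_14 (α κ : ℝ) (hα : 0 < α) (hκ : 1 < κ) (β : ℝ) (hβ : β = κ * α) :
    ∃ (f : lp (fun _ : ℕ => ℝ) 2 → ℝ) (xstar : lp (fun _ : ℕ => ℝ) 2),
      Differentiable ℝ f ∧
      (∀ x y : lp (fun _ : ℕ => ℝ) 2,
        ‖gradient f x - gradient f y‖ ≤ β * ‖x - y‖) ∧
      (∀ x y : lp (fun _ : ℕ => ℝ) 2,
        f x - f y ≤ ⟪gradient f x, x - y⟫ - α / 2 * ‖x - y‖ ^ 2) ∧
      (∀ y, f xstar ≤ f y) ∧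
      ∀ x : ℕ → lp (fun _ : ℕ => ℝ) 2, x 1 = 0 →
        (∀ s, 1 ≤ s →
          x (s + 1) ∈ Submodule.span ℝ ((fun r => gradient f (x r)) '' Set.Icc 1 s)) →
        ∀ t, 1 ≤ t →
          α / 2 * ((Real.sqrt κ - 1) / (Real.sqrt κ + 1)) ^ (2 * (t - 1)) *
              ‖x 1 - xstar‖ ^ 2 ≤ f (x t) - f xstar := by
  set r := Real.sqrt κ with hr
  have hr₁ : 1 < r := Real.lt_sqrt_of_sq_lt (by simpa using hκ)
  have hr₂ : r ^ 2 = κ := Real.sq_sqrt (by linarith)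
  set q := (r - 1) / (r + 1) with hq
  have hq₀ : 0 ≤ q := div_nonneg (by linarith) (by linarith)
  have hq₁ : q < 1 := (div_lt_one (by linarith)).2 (by linarith)
  obtain ⟨c, hc⟩ : ∃ c, c = α * (κ - 1) / 4 := ⟨_, rfl⟩
  have hc₀ : 0 ≤ c := hc ▸ div_nonneg (mul_nonneg hα.le (by linarith)) (by norm_num)
  have hcq : (2 * c + α) * q = c * (q ^ 2 + 1) := by
    have : r + 1 ≠ 0 := by linarith
    rw [hc, hq, ← hr₂]
    field_simp
    ring
  set T := shiftedLaplacian c α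
  set b : lp (fun _ : ℕ => ℝ) 2 := lp.single 2 0 c
  set z := geometricSeq q hq₀ hq₁
  have hT := inner_shiftedLaplacian_left c α
  have hgrad : gradient (fun x => 1 / 2 * ⟪T x, x⟫ - ⟪b, x⟫) = fun x => T x - b :=
    funext fun x => (hasGradientAt_quadratic hT b x).gradient
  have hconv : ∀ x y, (1 / 2 * ⟪T x, x⟫ - ⟪b, x⟫) - (1 / 2 * ⟪T y, y⟫ - ⟪b, y⟫) ≤
      ⟪T x - b, x - y⟫ - α / 2 * ‖x - y‖ ^ 2 := fun x y => by
    rw [quadratic_sub_quadratic hT]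
    linarith [mul_norm_sq_le_inner_shiftedLaplacian hc₀ α (x - y)]
  have hmin : ∀ y, α / 2 * ‖z - y‖ ^ 2 ≤
      (1 / 2 * ⟪T y, y⟫ - ⟪b, y⟫) - (1 / 2 * ⟪T z, z⟫ - ⟪b, z⟫) := fun y => by
    have h := hconv z y
    have hz : T z - b = 0 := sub_eq_zero.2 (shiftedLaplacian_geometricSeq hq₀ hq₁ hcq)
    rw [hz, inner_zero_left] at h
    linarith
  refine ⟨fun x => 1 / 2 * ⟪T x, x⟫ - ⟪b, x⟫, z,
    fun x => (hasGradientAt_quadratic hT b x).differentiableAt, ?_, ?_, ?_, ?_⟩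
  · intro x y
    rw [hgrad]
    have h := norm_shiftedLaplacian_apply_le hc₀ hα.le (x - y)
    rw [map_sub] at h
    rw [sub_sub_sub_cancel_right]
    refine h.trans_eq ?_
    rw [hc, hβ]
    ring
  · rw [hgrad]
    exact hconv
  · intro y
    have := hmin y
    have : 0 ≤ α / 2 * ‖z - y‖ ^ 2 := by positivity
    linarith
  · rw [hgrad]
    intro x hx₁ hx t ht
    obtain ⟨k, rfl⟩ := Nat.exists_eq_add_of_le' ht
    refine le_trans ?_ (hmin _)
    have hmem := mem_supportedBelow_of_mem_span (g := fun x => T x - b)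
      (fun k x hx => sub_mem (shiftedLaplacian_mem_supportedBelow_succ c α hx)
        (single_zero_mem_supportedBelow_succ k c)) hx₁ hx k
    have h := pow_mul_norm_geometricSeq_le hq₀ hq₁ hmem
    rw [hx₁, zero_sub, norm_neg, Nat.add_sub_cancel, mul_comm 2 k, pow_mul, mul_assoc, ← mul_pow]
    gcongr
end
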